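/- arXiv:2103.01784 — 2 statements merged into one kernel-verified Lean document; each statement's English description precedes it below -/
import Mathlib

section
/- Let p₄, p₅, p₆ ∈ 𝒪_K be odd prime elements with pairwise distinct associated places. Assume that σ(p₄) > 0 for every real embedding σ : K → ℝ, that p₄ is a square in K_v for every finite place v of K above 2, and that p₆ is a square in K_{v_{p₅}}. Then for every finite place v of K with v ≠ v_{p₄}, the polynomial g(x₀,x₁;y₀,y₁) = (x₀² − p₄x₁²)(x₀² − p₅x₁²)(x₀² − p₄p₅x₁²)(y₀² − p₆y₁²)(y₀³ − p₄y₁³) has a zero (x₀, x₁, y₀, y₁) with coordinates in K_v such that (x₀, x₁) ≠ (0,0) and (y₀, y₁) ≠ (0,0). -/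
open NumberField IsDedekindDomain

/-- Newton's method for square roots: in a complete nonarchimedean field of odd residue
characteristic, an element close to the square of a unit is a square. -/
theorem isSquare_of_norm_sq_sub_lt_one {L : Type*} [NormedField L] [IsUltrametricDist L]
    [CompleteSpace L] {a u : L} (h2 : ‖(2 : L)‖ = 1) (ha : ‖a‖ = 1) (hu : ‖a ^ 2 - u‖ < 1) :
    IsSquare u := by
  set r : ℝ := ‖a ^ 2 - u‖
  have h2a : ‖2 * a‖ = 1 := by rw [norm_mul, h2, ha, one_mul]
  have h2a0 : 2 * a ≠ 0 := norm_ne_zero_iff.mp (by rw [h2a]; exact one_ne_zero)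
  let f : L → L := fun x ↦ x - (x ^ 2 - u) / (2 * a)
  have hfa : ‖f a - a‖ = r := by
    rw [show f a - a = -((a ^ 2 - u) / (2 * a)) by simp only [f]; ring, norm_neg, norm_div, h2a,
      div_one]
  have hlip : ∀ x ∈ Metric.closedBall a r, ∀ y ∈ Metric.closedBall a r,
      ‖f x - f y‖ ≤ r * ‖x - y‖ := by
    intro x hx y hy
    rw [mem_closedBall_iff_norm'] at hx hy
    have hxy : ‖(a - x) + (a - y)‖ ≤ r :=
      (IsUltrametricDist.norm_add_le_max _ _).trans (max_le hx hy)
    rw [show f x - f y = ((a - x) + (a - y)) * (x - y) / (2 * a) by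
        simp only [f]
        rw [eq_div_iff h2a0, sub_mul, sub_mul, sub_mul, div_mul_cancel₀ _ h2a0,
          div_mul_cancel₀ _ h2a0]
        ring,
      norm_div, h2a, div_one, norm_mul]
    gcongr
  have hmaps : Set.MapsTo f (Metric.closedBall a r) (Metric.closedBall a r) := by
    intro x hx
    have h := hlip x hx a (Metric.mem_closedBall_self (norm_nonneg _))
    rw [mem_closedBall_iff_norm] at hx ⊢
    rw [← sub_add_sub_cancel _ (f a)]
    refine (IsUltrametricDist.norm_add_le_max _ _).trans (max_le (h.trans ?_) hfa.le)
    exact (mul_le_of_le_one_left (norm_nonneg _) hu.le).trans hx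
  have hcontr : ContractingWith ⟨r, norm_nonneg _⟩ (hmaps.restrict f _ _) := by
    refine ⟨hu, LipschitzWith.of_dist_le_mul fun x y ↦ ?_⟩
    rw [Subtype.dist_eq, Subtype.dist_eq, dist_eq_norm, dist_eq_norm]
    exact hlip x x.2 y y.2
  obtain ⟨y, -, hy, -⟩ := hcontr.exists_fixedPoint' Metric.isClosed_closedBall.isComplete hmaps
    (Metric.mem_closedBall_self (norm_nonneg _)) (edist_ne_top _ _)
  have hy0 : (y ^ 2 - u) / (2 * a) = 0 := sub_eq_self.mp hy
  refine ⟨y, ?_⟩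
  rw [← pow_two]
  exact (sub_eq_zero.mp ((div_eq_zero_iff.mp hy0).resolve_right h2a0)).symm

/-- In a finite field, one of `a`, `b`, `a * b` is a square. -/
theorem FiniteField.isSquare_or_isSquare_or_isSquare_mul {F : Type*} [Field F] [Finite F]
    (a b : F) : IsSquare a ∨ IsSquare b ∨ IsSquare (a * b) := by
  classical
  have := Fintype.ofFinite F
  rcases eq_or_ne a 0 with rfl | ha
  · exact .inl IsSquare.zero
  rcases eq_or_ne b 0 with rfl | hb
  · exact .inr (.inl IsSquare.zero)
  rw [← quadraticChar_one_iff_isSquare ha, ← quadraticChar_one_iff_isSquare hb,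
    ← quadraticChar_one_iff_isSquare (mul_ne_zero ha hb), map_mul]
  rcases quadraticChar_dichotomy ha with h | h <;> rcases quadraticChar_dichotomy hb with h' | h' <;>
    simp [h, h']

/-- At an odd finite place, an algebraic integer that is a unit and a square modulo the place is a
local square. -/
theorem isSquare_adicCompletion_of_isSquare_mk {K : Type*} [Field K] [NumberField K]
    {v : HeightOneSpectrum (𝓞 K)} (h2 : (2 : 𝓞 K) ∉ v.asIdeal) {u : 𝓞 K} (hu : u ∉ v.asIdeal)
    (hsq : IsSquare (Ideal.Quotient.mk v.asIdeal u)) :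
    IsSquare (algebraMap (𝓞 K) (v.adicCompletion K) u) := by
  obtain ⟨b, hb⟩ := hsq
  obtain ⟨a, rfl⟩ := Ideal.Quotient.mk_surjective b
  have hmem : a ^ 2 - u ∈ v.asIdeal := by
    rw [← Ideal.Quotient.eq_zero_iff_mem, map_sub, hb, map_pow, pow_two, sub_self]
  have ha : a ∉ v.asIdeal := fun h ↦ hu <| by
    simpa using sub_mem (Ideal.pow_mem_of_mem _ h 2 two_pos) hmem
  apply isSquare_of_norm_sq_sub_lt_one (a := algebraMap (𝓞 K) (v.adicCompletion K) a)
  · rw [← map_ofNat (algebraMap (𝓞 K) (v.adicCompletion K)) 2]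
    exact (FinitePlace.norm_eq_one_iff_notMem K v 2).mpr h2
  · exact (FinitePlace.norm_eq_one_iff_notMem K v a).mpr ha
  · rw [← map_pow, ← map_sub]
    exact (FinitePlace.norm_lt_one_iff_mem K v _).mpr hmem

/-- Let `p₄,p₅,p₆` be odd prime elements of `𝓞 K` with pairwise distinct places.  If `p₄`
is totally positive, `p₄` is a square in `K_v` for every finite place `v` above `2`, and
`p₆` is a square in `K_{v_{p₅}}`, then for every finite place `v ≠ v_{p₄}` the polynomial
`g = (x₀²−p₄x₁²)(x₀²−p₅x₁²)(x₀²−p₄p₅x₁²)(y₀²−p₆y₁²)(y₀³−p₄y₁³)` has a nontrivial zero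
over `K_v`. -/
theorem local_zero_off_v4
    (K : Type*) [Field K] [NumberField K]
    (p₄ p₅ p₆ : 𝓞 K) (hp₄ : Prime p₄) (hp₅ : Prime p₅) (hp₆ : Prime p₆)
    (v₄ v₅ v₆ : HeightOneSpectrum (𝓞 K))
    (hv₄ : v₄.asIdeal = Ideal.span {p₄}) (hv₅ : v₅.asIdeal = Ideal.span {p₅})
    (hv₆ : v₆.asIdeal = Ideal.span {p₆})
    (hodd₄ : (2 : 𝓞 K) ∉ v₄.asIdeal) (hodd₅ : (2 : 𝓞 K) ∉ v₅.asIdeal)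
    (hodd₆ : (2 : 𝓞 K) ∉ v₆.asIdeal)
    (hne₄₅ : v₄ ≠ v₅) (hne₄₆ : v₄ ≠ v₆) (hne₅₆ : v₅ ≠ v₆)
    (hpos : ∀ σ : K →+* ℝ, 0 < σ (algebraMap (𝓞 K) K p₄))
    (h2 : ∀ v : HeightOneSpectrum (𝓞 K), (2 : 𝓞 K) ∈ v.asIdeal →
      IsSquare (algebraMap (𝓞 K) (v.adicCompletion K) p₄))
    (hsq : IsSquare (algebraMap (𝓞 K) (v₅.adicCompletion K) p₆)) :
    ∀ v : HeightOneSpectrum (𝓞 K), v ≠ v₄ →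
      ∃ x₀ x₁ y₀ y₁ : v.adicCompletion K, ¬(x₀ = 0 ∧ x₁ = 0) ∧ ¬(y₀ = 0 ∧ y₁ = 0) ∧
        (x₀ ^ 2 - algebraMap (𝓞 K) (v.adicCompletion K) p₄ * x₁ ^ 2) *
        (x₀ ^ 2 - algebraMap (𝓞 K) (v.adicCompletion K) p₅ * x₁ ^ 2) *
        (x₀ ^ 2 - algebraMap (𝓞 K) (v.adicCompletion K) (p₄ * p₅) * x₁ ^ 2) *
        (y₀ ^ 2 - algebraMap (𝓞 K) (v.adicCompletion K) p₆ * y₁ ^ 2) *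
        (y₀ ^ 3 - algebraMap (𝓞 K) (v.adicCompletion K) p₄ * y₁ ^ 3) = 0 := by
  intro v hv
  have notMem_of_ne {w : HeightOneSpectrum (𝓞 K)} {p : 𝓞 K} (hw : w.asIdeal = Ideal.span {p})
      (hvw : v ≠ w) : p ∉ v.asIdeal := by
    intro h
    have hle : w.asIdeal ≤ v.asIdeal := by
      rwa [hw, Ideal.span_singleton_le_iff_mem]
    exact hvw (HeightOneSpectrum.ext (w.isMaximal.eq_of_le v.isPrime.ne_top hle).symm)
  by_cases h2v : (2 : 𝓞 K) ∈ v.asIdeal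
  · obtain ⟨s, hs⟩ := h2 v h2v
    exact ⟨s, 1, 1, 0, by simp, by simp, by rw [hs]; ring⟩
  by_cases hv5 : v = v₅
  · subst hv5
    obtain ⟨s, hs⟩ := hsq
    exact ⟨1, 0, s, 1, by simp, by simp, by rw [hs]; ring⟩
  have h4 := notMem_of_ne hv₄ hv
  have h5 := notMem_of_ne hv₅ hv5
  have h45 : p₄ * p₅ ∉ v.asIdeal := fun h ↦ (v.isPrime.mem_or_mem h).elim h4 h5
  have := v.asIdeal.finiteQuotientOfFreeOfNeBot v.ne_bot
  have := v.isMaximal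
  let _ := Ideal.Quotient.field v.asIdeal
  rcases FiniteField.isSquare_or_isSquare_or_isSquare_mul (Ideal.Quotient.mk v.asIdeal p₄)
    (Ideal.Quotient.mk v.asIdeal p₅) with h | h | h
  · obtain ⟨s, hs⟩ := isSquare_adicCompletion_of_isSquare_mk h2v h4 h
    exact ⟨s, 1, 1, 0, by simp, by simp, by rw [hs]; ring⟩
  · obtain ⟨s, hs⟩ := isSquare_adicCompletion_of_isSquare_mk h2v h5 h
    exact ⟨s, 1, 1, 0, by simp, by simp, by rw [hs]; ring⟩
  · rw [← map_mul] at h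
    obtain ⟨s, hs⟩ := isSquare_adicCompletion_of_isSquare_mk h2v h45 h
    exact ⟨s, 1, 1, 0, by simp, by simp, by rw [hs]; ring⟩
end

section
/- Let F = ℚ(i) be the field obtained from ℚ by adjoining an element i with i² = −1. Then the solutions in F of y² = x³ − 16 are exactly (x, y) = (0, 4i) and (x, y) = (0, −4i); that is, for x, y ∈ F, y² = x³ − 16 holds if and only if x = 0 and y = ±4i. In particular, the elliptic curve E : y² = x³ − 16 satisfies E(ℚ(i)) = {(0, 4i), (0, −4i), O}, where O is the point at infinity. -/
namespace Zsqrtd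

theorem exists_abs_norm_sub_mul_lt {d : ℤ} (hsq : ∀ n : ℤ, d ≠ n * n)
    (hd : ∀ n a b : ℤ, n ≠ 0 → 2 * |a| ≤ |n| → 2 * |b| ≤ |n| → |a ^ 2 - d * b ^ 2| < n ^ 2)
    (x : ℤ√d) {y : ℤ√d} (hy : y ≠ 0) : ∃ q : ℤ√d, |(x - y * q).norm| < |y.norm| := by
  have hN : y.norm ≠ 0 := mt (norm_eq_zero hsq y).1 hy
  have key : ∀ u : ℤ, ∃ q : ℤ, 2 * |u - y.norm * q| ≤ |y.norm| := fun u ↦ by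
    refine ⟨round ((u : ℚ) / y.norm), ?_⟩
    have h := abs_sub_round ((u : ℚ) / y.norm)
    have hN' : (y.norm : ℚ) ≠ 0 := mod_cast hN
    have h2 : (u : ℚ) - y.norm * round ((u : ℚ) / y.norm) =
        y.norm * ((u : ℚ) / y.norm - round ((u : ℚ) / y.norm)) := by field_simp
    have h3 : 2 * |(u : ℚ) - y.norm * round ((u : ℚ) / y.norm)| ≤ |(y.norm : ℚ)| := by
      rw [h2, abs_mul]
      nlinarith [abs_nonneg (y.norm : ℚ)]
    exact mod_cast h3
  obtain ⟨q₁, h₁⟩ := key (x * star y).re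
  obtain ⟨q₂, h₂⟩ := key (x * star y).im
  refine ⟨⟨q₁, q₂⟩, ?_⟩
  have h := hd _ _ _ hN h₁ h₂
  have e : ((x * star y).re - y.norm * q₁) ^ 2 - d * ((x * star y).im - y.norm * q₂) ^ 2 =
      (x - y * ⟨q₁, q₂⟩).norm * y.norm := by
    simp only [norm_def, re_mul, im_mul, re_star, im_star, re_sub, im_sub]
    ring
  rw [e, abs_mul, ← sq_abs y.norm, sq] at h
  exact lt_of_mul_lt_mul_right h (abs_nonneg _)

theorem isDomain_of_forall_ne_mul_self {d : ℤ} (hsq : ∀ n : ℤ, d ≠ n * n) : IsDomain (ℤ√d) :=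
  have : NoZeroDivisors (ℤ√d) := ⟨fun {a b} h ↦ by
    have h' := congrArg norm h
    rwa [norm_mul, norm_zero, mul_eq_zero, norm_eq_zero hsq, norm_eq_zero hsq] at h'⟩
  NoZeroDivisors.to_isDomain _

theorem isPrincipalIdealRing {d : ℤ} (hsq : ∀ n : ℤ, d ≠ n * n)
    (hd : ∀ n a b : ℤ, n ≠ 0 → 2 * |a| ≤ |n| → 2 * |b| ≤ |n| → |a ^ 2 - d * b ^ 2| < n ^ 2) :
    IsPrincipalIdealRing (ℤ√d) := by
  refine ⟨fun I ↦ ?_⟩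
  by_cases hI : I = ⊥
  · exact hI ▸ bot_isPrincipal
  obtain ⟨y₀, hy₀, hy₀'⟩ := Submodule.exists_mem_ne_zero_of_ne_bot hI
  obtain ⟨y, ⟨hyI, hy0⟩, hmin⟩ := (measure fun y : ℤ√d ↦ y.norm.natAbs).wf.has_min
    {y | y ∈ I ∧ y ≠ 0} ⟨y₀, hy₀, hy₀'⟩
  refine ⟨⟨y, _root_.le_antisymm (fun x hx ↦ ?_) ((Ideal.span_singleton_le_iff_mem I).2 hyI)⟩⟩
  obtain ⟨q, hq⟩ := exists_abs_norm_sub_mul_lt hsq hd x hy0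
  refine Ideal.mem_span_singleton.2 ⟨q, ?_⟩
  by_contra hne
  refine hmin (x - y * q) ⟨I.sub_mem hx (I.mul_mem_right q hyI), sub_ne_zero.2 hne⟩ ?_
  change (x - y * q).norm.natAbs < y.norm.natAbs
  zify
  exact hq

theorem exists_associated_cube {d : ℤ} (hsq : ∀ n : ℤ, d ≠ n * n)
    (hd : ∀ n a b : ℤ, n ≠ 0 → 2 * |a| ≤ |n| → 2 * |b| ≤ |n| → |a ^ 2 - d * b ^ 2| < n ^ 2)
    {x y z : ℤ} (h : x ^ 2 - d * y ^ 2 = z ^ 3) (hcop : IsCoprime (2 * x) z) :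
    ∃ c : ℤ√d, Associated (c ^ 3) ⟨x, y⟩ := by
  have := isDomain_of_forall_ne_mul_self hsq
  have := isPrincipalIdealRing hsq hd
  let := UniqueFactorizationMonoid.toGCDMonoid (ℤ√d)
  have hmul : (⟨x, y⟩ : ℤ√d) * ⟨x, -y⟩ = (z : ℤ√d) ^ 3 := by
    rw [← Int.cast_pow, ← h]
    ext
    · simp only [re_mul, re_intCast]; ring
    · simp only [im_mul, im_intCast]; ring
  have hcop' : IsCoprime (⟨x, y⟩ : ℤ√d) ⟨x, -y⟩ := by
    obtain ⟨u, v, huv⟩ := hcop.pow_right (n := 3)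
    refine ⟨u + v * ⟨x, -y⟩, u, ?_⟩
    have h1 : ((u * (2 * x) + v * z ^ 3 : ℤ) : ℤ√d) = 1 := by rw [huv]; simp
    push_cast at h1
    rw [← hmul] at h1
    have h2 : (⟨x, y⟩ : ℤ√d) + ⟨x, -y⟩ = 2 * (x : ℤ√d) := by
      ext
      · simp; ring
      · simp
    linear_combination h1 + u * h2
  exact exists_associated_pow_of_mul_eq_pow
    (hcop'.isUnit_of_dvd' (gcd_dvd_left _ _) (gcd_dvd_right _ _)) hmul

end Zsqrtd

theorem exists_cube_of_sq_add_sq {x y z : ℤ} (h : x ^ 2 + y ^ 2 = z ^ 3)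
    (hcop : IsCoprime (2 * x) z) :
    ∃ p q : ℤ, x = p * (p ^ 2 - 3 * q ^ 2) ∧ y = q * (3 * p ^ 2 - q ^ 2) := by
  obtain ⟨c, u, hu⟩ := Zsqrtd.exists_associated_cube (d := -1) (x := x) (y := y) (z := z)
    (fun n ↦ by nlinarith [mul_self_nonneg n])
    (fun n a b hn ha hb ↦ by
      rw [abs_of_nonneg (by nlinarith [sq_nonneg a, sq_nonneg b]), ← sq_abs a, ← sq_abs b, ← sq_abs n]
      have := abs_pos.2 hn
      nlinarith [abs_nonneg a, abs_nonneg b])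
    (by linarith) hcop
  have hnorm : (u : ℤ√(-1)).norm = 1 :=
    (Zsqrtd.norm_eq_one_iff' (by norm_num) _).2 u.isUnit
  have h4 : (u : ℤ√(-1)) ^ 4 = 1 := by
    generalize (u : ℤ√(-1)) = w at hnorm
    obtain ⟨a, b⟩ := w
    simp only [Zsqrtd.norm_def] at hnorm
    have ha : |a| ≤ 1 := by
      rw [← sq_le_one_iff_abs_le_one]
      nlinarith [mul_self_nonneg b]
    have hb : |b| ≤ 1 := by
      rw [← sq_le_one_iff_abs_le_one]
      nlinarith [mul_self_nonneg a]
    rw [abs_le] at ha hb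
    obtain ⟨ha, ha'⟩ := ha
    obtain ⟨hb, hb'⟩ := hb
    interval_cases a <;> interval_cases b <;> first | omega | decide
  have hcube : (c * u ^ 3) ^ 3 = (⟨x, y⟩ : ℤ√(-1)) := by
    rw [← hu]
    linear_combination c ^ 3 * (u : ℤ√(-1)) * (u ^ 4 + 1) * h4
  generalize c * (u : ℤ√(-1)) ^ 3 = w at hcube
  obtain ⟨p, q⟩ := w
  refine ⟨p, q, ?_, ?_⟩
  · have := congrArg Zsqrtd.re hcube
    simp [pow_succ] at this
    linear_combination -this
  · have := congrArg Zsqrtd.im hcube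
    simp [pow_succ] at this
    linear_combination -this

theorem isFundamental_two_one :
    Pell.IsFundamental (Pell.Solution₁.mk 2 1 (d := 3) (by norm_num)) := by
  refine ⟨by simp, by simp, fun {b} hb ↦ ?_⟩
  rw [Pell.Solution₁.x_mk]
  omega

theorem exists_unit_mul_cube_of_sq_sub_three_mul_sq {x y z : ℤ} (h : x ^ 2 - 3 * y ^ 2 = z ^ 3)
    (hcop : IsCoprime (2 * x) z) :
    ∃ r s : ℤ, ∃ ε ∈ ({(1, 0), (2, 1), (2, -1)} : Set (ℤ × ℤ)),
      x = ε.1 * (r ^ 3 + 9 * r * s ^ 2) + 3 * ε.2 * (3 * r ^ 2 * s + 3 * s ^ 3) ∧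
      y = ε.1 * (3 * r ^ 2 * s + 3 * s ^ 3) + ε.2 * (r ^ 3 + 9 * r * s ^ 2) := by
  have hsq : ∀ n : ℤ, (3 : ℤ) ≠ n * n := fun n hn ↦ by
    have h1 : n ≤ 1 := by nlinarith
    have h2 : -1 ≤ n := by nlinarith
    interval_cases n <;> omega
  obtain ⟨c, u, hu⟩ := Zsqrtd.exists_associated_cube (d := 3) (x := x) (y := y) (z := z) hsq
    (fun n a b hn ha hb ↦ by
      rw [← sq_abs a, ← sq_abs b, ← sq_abs n]
      have := abs_pos.2 hn
      rw [abs_lt]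
      constructor <;> nlinarith [abs_nonneg a, abs_nonneg b])
    h hcop
  have hnorm : (u : ℤ√3).norm = 1 := by
    have h1 := Int.natAbs_eq_iff.1 (Zsqrtd.norm_eq_one_iff.2 u.isUnit)
    rcases h1 with h1 | h1
    · simpa using h1
    · exfalso
      simp only [Zsqrtd.norm_def] at h1
      have h2 : (u : ℤ√3).re * (u : ℤ√3).re % 3 = 2 := by
        push_cast at h1
        rw [mul_assoc] at h1
        omega
      have h3 : (u : ℤ√3).re % 3 = 0 ∨ (u : ℤ√3).re % 3 = 1 ∨ (u : ℤ√3).re % 3 = 2 := by omega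
      rw [Int.mul_emod] at h2
      rcases h3 with h3 | h3 | h3 <;> rw [h3] at h2 <;> omega
  set g : Pell.Solution₁ 3 := Pell.Solution₁.mk 2 1 (by norm_num)
  obtain ⟨v, e, he, hv⟩ : ∃ v e : Pell.Solution₁ 3, (e = 1 ∨ e = g ∨ e = g⁻¹) ∧
      Pell.Solution₁.mk (u : ℤ√3).re (u : ℤ√3).im (by rw [← hnorm, Zsqrtd.norm_def]; ring) =
        v ^ 3 * e := by
    obtain ⟨n, hn⟩ := isFundamental_two_one.eq_zpow_or_neg_zpow
      (Pell.Solution₁.mk (u : ℤ√3).re (u : ℤ√3).im (by rw [← hnorm, Zsqrtd.norm_def]; ring))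
    obtain ⟨j, k, rfl, hk⟩ : ∃ j k : ℤ, n = j * 3 + k ∧ (k = 0 ∨ k = 1 ∨ k = -1) :=
      ⟨(n + 1) / 3, (n + 1) % 3 - 1, by omega, by omega⟩
    have hj : g ^ (j * 3 + k) = (g ^ j) ^ 3 * g ^ k := by
      rw [zpow_add, zpow_mul]; rfl
    have hk' : g ^ k = 1 ∨ g ^ k = g ∨ g ^ k = g⁻¹ := by
      rcases hk with rfl | rfl | rfl <;> simp
    rcases hn with hn | hn
    · exact ⟨g ^ j, g ^ k, hk', hn.trans hj⟩
    · refine ⟨-g ^ j, g ^ k, hk', hn.trans ?_⟩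
      rw [hj, Odd.neg_pow (by decide), neg_mul]
  have hval : (u : ℤ√3) = (v : ℤ√3) ^ 3 * (e : ℤ√3) := congrArg Subtype.val hv
  have hcube : (c * (v : ℤ√3)) ^ 3 * (e : ℤ√3) = ⟨x, y⟩ := by
    rw [← hu, hval]; ring
  generalize c * (v : ℤ√3) = w at hcube
  obtain ⟨r, s⟩ := w
  have hre := congrArg Zsqrtd.re hcube
  have him := congrArg Zsqrtd.im hcube
  refine ⟨r, s, (e.x, e.y), ?_, ?_, ?_⟩
  · rcases he with rfl | rfl | rfl <;> simp [g]
  · change _ = x at hre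
    simp only [pow_succ, pow_zero, one_mul, Zsqrtd.re_mul, Zsqrtd.im_mul] at hre
    rw [← hre]
    simp only [Pell.Solution₁.x, Pell.Solution₁.y]
    ring
  · change _ = y at him
    simp only [pow_succ, pow_zero, one_mul, Zsqrtd.re_mul, Zsqrtd.im_mul] at him
    rw [← him]
    simp only [Pell.Solution₁.x, Pell.Solution₁.y]
    ring

theorem odd_of_sq_add_sixteen_mul_pow_six {a b c : ℤ} (h : b ^ 2 + 16 * c ^ 6 = a ^ 3)
    (hbc : IsCoprime b c) : Odd b := by
  by_contra hb
  obtain ⟨k, rfl⟩ := even_iff_two_dvd.1 (Int.not_odd_iff_even.1 hb)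
  have hc : Odd c := Int.isCoprime_two_left.1 hbc.of_mul_left_left
  obtain ⟨l, rfl⟩ : (2 : ℤ) ∣ a :=
    Int.prime_two.dvd_of_dvd_pow (n := 3) ⟨2 * k ^ 2 + 8 * c ^ 6, by rw [← h]; ring⟩
  obtain ⟨m, rfl⟩ : (2 : ℤ) ∣ k :=
    Int.prime_two.dvd_of_dvd_pow (n := 2) ⟨l ^ 3 - 2 * c ^ 6, by linarith⟩
  obtain ⟨n, rfl⟩ : (2 : ℤ) ∣ l :=
    Int.prime_two.dvd_of_dvd_pow (n := 3) ⟨m ^ 2 + c ^ 6, by linarith⟩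
  obtain ⟨e, he⟩ := hc.pow (n := 3)
  have h' : m ^ 2 + (2 * e + 1) ^ 2 = 4 * n ^ 3 := by rw [← he]; linarith
  rcases Int.even_or_odd' m with ⟨f, rfl | rfl⟩ <;> ring_nf at h' <;> omega

theorem three_dvd_of_cast_cube_eq_zero {m : ℤ} (h : (m : ZMod 9) ^ 3 = 0) : 3 ∣ m := by
  have h9 : (9 : ℤ) ∣ m ^ 3 := (ZMod.intCast_zmod_eq_zero_iff_dvd _ 9).1 (mod_cast h)
  exact Int.prime_three.dvd_of_dvd_pow (dvd_trans ⟨3, by norm_num⟩ h9)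

theorem three_dvd_of_three_mul_sq_sub {p m n : ℤ} (h : 3 * p ^ 2 - 16 * m ^ 6 = n ^ 3) :
    3 ∣ m := by
  have key : ∀ x y z : ZMod 9, 3 * x ^ 2 - 16 * y ^ 6 = z ^ 3 → y ^ 3 = 0 := by decide +kernel
  exact three_dvd_of_cast_cube_eq_zero (key p m n (mod_cast congrArg (Int.cast : ℤ → ZMod 9) h))

theorem three_dvd_of_two_mul_add {r s d ε : ℤ}
    (h : 12 * d ^ 3 = 2 * (3 * r ^ 2 * s + 3 * s ^ 3) + ε * (r ^ 3 + 9 * r * s ^ 2))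
    (hr : 3 ∣ r) : 3 ∣ s := by
  obtain ⟨t, rfl⟩ := hr
  have h' : 4 * d ^ 3 = 2 * s ^ 3 + 9 * (2 * t ^ 2 * s + ε * (t ^ 3 + t * s ^ 2)) := by linarith
  have h9 := congrArg (Int.cast : ℤ → ZMod 9) h'
  have h0 : (9 : ZMod 9) = 0 := rfl
  push_cast at h9
  rw [h0, zero_mul, add_zero] at h9
  have key : ∀ x y : ZMod 9, 4 * x ^ 3 = 2 * y ^ 3 → y ^ 3 = 0 := by decide +kernel
  exact three_dvd_of_cast_cube_eq_zero (key d s h9)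

theorem IsCoprime.sq_add_mul_right {x y : ℤ} (h : IsCoprime x y) (k : ℤ) :
    IsCoprime x (y ^ 2 + x * k) :=
  IsCoprime.add_mul_left_right h.pow_right k

theorem exists_descent_of_sq_sub {p d e : ℤ} (h : p ^ 2 - 432 * d ^ 6 = e ^ 3) (hd : d ≠ 0)
    (hp : Odd p) (hp3 : ¬ 3 ∣ p) (hpd : IsCoprime p d) :
    ∃ r m n : ℤ, r ^ 2 + 16 * m ^ 6 = n ^ 3 ∧ m ≠ 0 ∧ IsCoprime r m ∧ m ∣ d := by
  have hp2 : IsCoprime p 2 := Int.isCoprime_two_right.2 hp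
  have hp3' : IsCoprime p 3 := ((Int.prime_three.coprime_iff_not_dvd).2 hp3).symm
  have hpe : IsCoprime p e := by
    have h1 : IsCoprime p (-(2 ^ 4 * 3 ^ 3 * d ^ 6) + p * p) :=
      (((hp2.pow_right.mul_right hp3'.pow_right).mul_right hpd.pow_right).neg_right
        ).add_mul_left_right p
    rw [show -(2 ^ 4 * 3 ^ 3 * d ^ 6) + p * p = e ^ 3 by rw [← h]; ring] at h1
    exact (IsCoprime.pow_right_iff (by norm_num)).1 h1
  have he : Odd e := by
    rw [← Int.odd_pow' (n := 3) (by norm_num), ← h]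
    exact hp.pow.sub_even ((by decide : Even (432 : ℤ)).mul_right _)
  obtain ⟨r, s, ε, hε, h1, h2⟩ := exists_unit_mul_cube_of_sq_sub_three_mul_sq
    (x := p) (y := 12 * d ^ 3) (z := e) (by rw [← h]; ring)
    ((Int.isCoprime_two_left.2 he).mul_left hpe)
  by_cases hε1 : ε = (1, 0)
  · subst hε1
    have h1' : p = r * (r ^ 2 + 9 * s ^ 2) := by rw [h1]; ring
    have h2' : 2 ^ 2 * d ^ 3 = s * (r ^ 2 + s ^ 2) := by
      simp only at h2
      linarith
    have hr : Odd r := by rw [h1'] at hp; exact (Int.odd_mul.1 hp).1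
    have hs : Even s := by
      rw [h1'] at hp
      by_contra hs
      rw [Int.not_even_iff_odd] at hs
      have := (hr.pow (n := 2)).add_odd ((by decide : Odd (9 : ℤ)).mul (hs.pow (n := 2)))
      exact Int.not_even_iff_odd.2 (Int.odd_mul.1 hp).2 this
    have hrs : IsCoprime r s := by
      have : IsCoprime r (2 ^ 2 * d ^ 3) := by
        rw [h1'] at hp2 hpd
        exact hp2.of_mul_left_left.pow_right.mul_right hpd.of_mul_left_left.pow_right
      rw [h2'] at this
      exact this.of_mul_right_left
    have h4 : (2 ^ 2 : ℤ) ∣ s := by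
      refine IsCoprime.dvd_of_dvd_mul_right (IsCoprime.pow_left (Int.isCoprime_two_left.2 ?_))
        ⟨d ^ 3, h2'.symm⟩
      exact hr.pow.add_even (hs.pow_of_ne_zero (by norm_num))
    obtain ⟨t, rfl⟩ := h4
    have h5 : t * (r ^ 2 + 16 * t ^ 2) = d ^ 3 := by linarith
    have hrt : IsCoprime r t := hrs.of_mul_right_right
    have hcop : IsCoprime t (r ^ 2 + 16 * t ^ 2) := by
      rw [show r ^ 2 + 16 * t ^ 2 = r ^ 2 + t * (16 * t) by ring]
      exact hrt.symm.sq_add_mul_right _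
    obtain ⟨⟨m, hm⟩, n, hn⟩ := Int.eq_pow_of_mul_eq_pow_odd hcop (by decide : Odd 3) h5
    refine ⟨r, m, n, by rw [← hn, hm]; ring, ?_, ?_, ?_⟩
    · rintro rfl
      refine pow_ne_zero 3 hd ?_
      rw [← h5, hm]
      ring
    · rw [hm] at hrt
      exact (IsCoprime.pow_right_iff (by norm_num)).1 hrt
    · refine (Int.pow_dvd_pow_iff (n := 3) (by norm_num)).1 ⟨n ^ 3, ?_⟩
      rw [← h5, hn, hm]
  · exfalso
    obtain ⟨hε2, hε3⟩ : ε.1 = 2 ∧ ε.2 ^ 2 = 1 := by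
      rcases hε with rfl | rfl | rfl <;> simp at hε1 ⊢
    rw [hε2] at h1 h2
    have hr : 3 ∣ r := by
      refine Int.prime_three.dvd_of_dvd_pow (n := 3)
        ⟨ε.2 * (4 * d ^ 3 - 2 * (r ^ 2 * s + s ^ 3)) - 3 * r * s ^ 2, ?_⟩
      linear_combination -ε.2 * h2 - (r ^ 3 + 9 * r * s ^ 2) * hε3
    have hs : 3 ∣ s := three_dvd_of_two_mul_add h2 hr
    refine hp3 ?_
    rw [h1]
    exact dvd_add (Dvd.dvd.mul_left (dvd_add (dvd_pow hr (by norm_num))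
      (Dvd.dvd.mul_left (dvd_pow hs (by norm_num)) _)) _) (Dvd.dvd.mul_right ⟨ε.2, rfl⟩ _)

theorem exists_descent {a b c : ℤ} (h : b ^ 2 + 16 * c ^ 6 = a ^ 3) (hc : c ≠ 0)
    (hbc : IsCoprime b c) :
    ∃ b' c' a' : ℤ, b' ^ 2 + 16 * c' ^ 6 = a' ^ 3 ∧ c' ≠ 0 ∧ IsCoprime b' c' ∧
      c'.natAbs < c.natAbs := by
  have hb : Odd b := odd_of_sq_add_sixteen_mul_pow_six h hbc
  have hb2 : IsCoprime b 2 := Int.isCoprime_two_right.2 hb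
  have ha : Odd a := by
    rw [← Int.odd_pow' (n := 3) (by norm_num), ← h]
    exact hb.pow.add_even ((by decide : Even (16 : ℤ)).mul_right _)
  have hba : IsCoprime b a := by
    have h1 : IsCoprime b (2 ^ 4 * c ^ 6 + b * b) :=
      (hb2.pow_right.mul_right hbc.pow_right).add_mul_left_right b
    rw [show 2 ^ 4 * c ^ 6 + b * b = a ^ 3 by rw [← h]; ring] at h1
    exact (IsCoprime.pow_right_iff (by norm_num)).1 h1
  obtain ⟨p, q, rfl, hq⟩ := exists_cube_of_sq_add_sq (x := b) (y := 2 ^ 2 * c ^ 3) (z := a)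
    (by rw [← h]; ring) ((Int.isCoprime_two_left.2 ha).mul_left hba)
  obtain ⟨hp, hpq⟩ := Int.odd_mul.1 hb
  have hqe : Even q := by
    by_contra hq'
    rw [Int.not_even_iff_odd] at hq'
    exact Int.not_even_iff_odd.2 hpq (hp.pow.sub_odd ((by decide : Odd (3 : ℤ)).mul hq'.pow))
  have hcop : IsCoprime p q := by
    have : IsCoprime p (2 ^ 2 * c ^ 3) :=
      hb2.of_mul_left_left.pow_right.mul_right hbc.of_mul_left_left.pow_right
    rw [hq] at this
    exact this.of_mul_right_left
  have h4 : (2 ^ 2 : ℤ) ∣ q := by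
    refine IsCoprime.dvd_of_dvd_mul_right (IsCoprime.pow_left (Int.isCoprime_two_left.2 ?_))
      ⟨c ^ 3, hq.symm⟩
    exact ((by decide : Odd (3 : ℤ)).mul hp.pow).sub_even (hqe.pow_of_ne_zero (by norm_num))
  obtain ⟨t, rfl⟩ := h4
  have hpt : IsCoprime p t := hcop.of_mul_right_right
  have h5 : t * (3 * p ^ 2 - 16 * t ^ 2) = c ^ 3 := by linarith
  have h3t : 3 ∣ t := by
    by_contra h3
    have h3t : IsCoprime t 3 := ((Int.prime_three.coprime_iff_not_dvd).2 h3).symm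
    have hcop' : IsCoprime t (3 * p ^ 2 - 16 * t ^ 2) := by
      rw [show 3 * p ^ 2 - 16 * t ^ 2 = 3 * p ^ 2 + t * (-16 * t) by ring]
      exact (h3t.mul_right hpt.symm.pow_right).add_mul_left_right _
    obtain ⟨⟨m, hm⟩, n, hn⟩ := Int.eq_pow_of_mul_eq_pow_odd hcop' (by decide : Odd 3) h5
    refine h3 ?_
    rw [hm]
    refine dvd_pow (three_dvd_of_three_mul_sq_sub (p := p) (n := n) ?_) (by norm_num)
    rw [← hn, hm]; ring
  obtain ⟨u, rfl⟩ := h3t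
  have hp3 : ¬ 3 ∣ p := (Int.prime_three.coprime_iff_not_dvd).1 hpt.of_mul_right_left.symm
  obtain ⟨v, rfl⟩ : 3 ∣ c := Int.prime_three.dvd_of_dvd_pow (n := 3)
    ⟨3 * u * (p ^ 2 - 48 * u ^ 2), by rw [← h5]; ring⟩
  have h6 : u * (p ^ 2 - 48 * u ^ 2) = 3 * v ^ 3 := by linarith
  have h3u : 3 ∣ u := by
    refine (Int.prime_three.dvd_or_dvd ⟨_, h6⟩).resolve_right fun h3 ↦ hp3 ?_
    refine Int.prime_three.dvd_of_dvd_pow (n := 2) ?_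
    rw [show p ^ 2 = p ^ 2 - 48 * u ^ 2 + 3 * (16 * u ^ 2) by ring]
    exact dvd_add h3 ⟨_, rfl⟩
  obtain ⟨w, rfl⟩ := h3u
  have h7 : w * (p ^ 2 - 432 * w ^ 2) = v ^ 3 := by linarith
  have hpw : IsCoprime p w := hpt.of_mul_right_right.of_mul_right_right
  have hcop' : IsCoprime w (p ^ 2 - 432 * w ^ 2) := by
    rw [show p ^ 2 - 432 * w ^ 2 = p ^ 2 + w * (-432 * w) by ring]
    exact hpw.symm.sq_add_mul_right _
  obtain ⟨⟨d, rfl⟩, e, he⟩ := Int.eq_pow_of_mul_eq_pow_odd hcop' (by decide : Odd 3) h7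
  have hv : v ≠ 0 := right_ne_zero_of_mul hc
  have hdv : d ∣ v := (Int.pow_dvd_pow_iff (n := 3) (by norm_num)).1 ⟨_, h7.symm⟩
  obtain ⟨r, m, n, hr, hm, hrm, hmd⟩ := exists_descent_of_sq_sub (p := p) (d := d) (e := e)
    (by rw [← he]; ring) (fun hd ↦ hv (zero_dvd_iff.1 (hd ▸ hdv))) hp hp3
    ((IsCoprime.pow_right_iff (by norm_num)).1 hpw)
  refine ⟨r, m, n, hr, hm, hrm, ?_⟩
  have := Int.natAbs_le_of_dvd_ne_zero (hmd.trans hdv) hv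
  omega

theorem sq_add_sixteen_mul_pow_six_ne_cube (N : ℕ) : ∀ {a b c : ℤ}, c.natAbs = N → c ≠ 0 →
    IsCoprime b c → b ^ 2 + 16 * c ^ 6 ≠ a ^ 3 := by
  induction N using Nat.strong_induction_on with
  | _ N ih =>
    rintro a b c rfl hc hbc h
    obtain ⟨b', c', a', h', hc', hbc', hlt⟩ := exists_descent h hc hbc
    exact ih _ hlt rfl hc' hbc' h'

theorem Int.eq_zero_of_cube_add_cube {x y z : ℤ} (h : x ^ 3 + y ^ 3 = z ^ 3) :
    x = 0 ∨ y = 0 ∨ z = 0 := by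
  by_contra! hne
  exact fermatLastTheoremFor_iff_int.1 fermatLastTheoremThree x y z hne.1 hne.2.1 hne.2.2 h

theorem eq_zero_of_sq_eq_cube_add_sixteen_mul_pow_six {a b c : ℤ}
    (h : b ^ 2 = a ^ 3 + 16 * c ^ 6) (hc : c ≠ 0) (hbc : IsCoprime b c) : a = 0 := by
  rcases Int.even_or_odd b with hb | hb
  · obtain ⟨k, rfl⟩ := even_iff_two_dvd.1 hb
    have hco : Odd c := Int.isCoprime_two_left.1 hbc.of_mul_left_left
    obtain ⟨l, rfl⟩ : (2 : ℤ) ∣ a :=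
      Int.prime_two.dvd_of_dvd_pow (n := 3) ⟨2 * k ^ 2 - 8 * c ^ 6, by linarith⟩
    obtain ⟨m, rfl⟩ : (2 : ℤ) ∣ k :=
      Int.prime_two.dvd_of_dvd_pow (n := 2) ⟨l ^ 3 + 2 * c ^ 6, by linarith⟩
    obtain ⟨n, rfl⟩ : (2 : ℤ) ∣ l :=
      Int.prime_two.dvd_of_dvd_pow (n := 3) ⟨m ^ 2 - c ^ 6, by linarith⟩
    have h1 : m ^ 2 = 4 * n ^ 3 + c ^ 6 := by linarith
    have hm : Odd m := by
      rw [← Int.odd_pow' (n := 2) (by norm_num), h1]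
      exact ((by decide : Even (4 : ℤ)).mul_right _).add_odd hco.pow
    obtain ⟨u, hu⟩ := even_iff_two_dvd.1 (hm.sub_odd (hco.pow (n := 3)))
    obtain rfl : m = 2 * u + c ^ 3 := by linarith
    have h2 : u * (u + c ^ 3) = n ^ 3 := by linarith
    have hcop : IsCoprime u (u + c ^ 3) := by
      have h3 : IsCoprime (c ^ 3 + u * 2) (c ^ 3) := by
        rw [show c ^ 3 + u * 2 = 2 * u + c ^ 3 by ring]
        exact hbc.of_mul_left_right.of_mul_left_right.pow_right
      have h4 : IsCoprime (u * 2) (c ^ 3) := by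
        simpa using h3.add_mul_left_left (-1)
      have := h4.of_mul_left_left.add_mul_left_right 1
      rwa [mul_one, add_comm] at this
    obtain ⟨⟨s, hs⟩, t, ht⟩ := Int.eq_pow_of_mul_eq_pow_odd hcop (by decide : Odd 3) h2
    have hn : n = 0 := by
      refine pow_eq_zero_iff (n := 3) (by norm_num) |>.1 ?_
      rw [← h2, ht, hs]
      rcases Int.eq_zero_of_cube_add_cube (x := s) (y := c) (z := t) (by rw [← ht, hs]) with
        rfl | rfl | rfl
      · simp
      · exact absurd rfl hc
      · simp
    simp [hn]
  · have hb2 : IsCoprime b 2 := Int.isCoprime_two_right.2 hb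
    have h1 : (b - 4 * c ^ 3) * (b + 4 * c ^ 3) = a ^ 3 := by linarith
    have hcop : IsCoprime (b - 4 * c ^ 3) (b + 4 * c ^ 3) := by
      have ho : Odd (b - 4 * c ^ 3) := hb.sub_even ((by decide : Even (4 : ℤ)).mul_right _)
      have h3 : IsCoprime (b + c * (-4 * c ^ 2)) c := hbc.add_mul_left_left _
      rw [show b + c * (-4 * c ^ 2) = b - 4 * c ^ 3 by ring] at h3
      have h4 := ((Int.isCoprime_two_right.2 ho).pow_right (n := 3)).mul_right
        (h3.pow_right (n := 3))
      have := h4.add_mul_left_right 1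
      rwa [show 2 ^ 3 * c ^ 3 + (b - 4 * c ^ 3) * 1 = b + 4 * c ^ 3 by ring] at this
    obtain ⟨⟨s, hs⟩, t, ht⟩ := Int.eq_pow_of_mul_eq_pow_odd hcop (by decide : Odd 3) h1
    refine pow_eq_zero_iff (n := 3) (by norm_num) |>.1 ?_
    rw [← h1, ht, hs]
    rcases Int.eq_zero_of_cube_add_cube (x := s) (y := 2 * c) (z := t)
      (by rw [← ht, ← hs]; ring) with rfl | h0 | rfl
    · simp
    · exact absurd h0 (mul_ne_zero two_ne_zero hc)
    · simp

theorem Rat.exists_eq_div_of_sq_eq_cube_add {x y : ℚ} {k : ℤ} (h : y ^ 2 = x ^ 3 + k) :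
    ∃ a b c : ℤ, c ≠ 0 ∧ IsCoprime b c ∧ x = a / c ^ 2 ∧ y = b / c ^ 3 := by
  have hden : y.den ^ 2 = x.den ^ 3 := by
    rw [← Rat.den_pow, h, Rat.add_intCast_den, Rat.den_pow]
  obtain ⟨c, hc⟩ : x.den ∣ y.den :=
    (Nat.pow_dvd_pow_iff (n := 2) (by norm_num)).1 (hden ▸ pow_dvd_pow _ (by norm_num))
  have hx : x.den = c ^ 2 := by
    have := pow_pos x.den_pos 2
    rw [hc] at hden
    nlinarith
  have hy : y.den = c ^ 3 := by rw [hc, hx]; ring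
  have hc0 : c ≠ 0 := by
    rintro rfl
    exact y.den_ne_zero (by simp [hy])
  refine ⟨x.num, y.num, c, mod_cast hc0, ?_, ?_, ?_⟩
  · have hcop : IsCoprime y.num (y.den : ℤ) := by
      rw [Int.isCoprime_iff_nat_coprime]
      exact y.reduced
    rw [hy, Nat.cast_pow] at hcop
    exact (IsCoprime.pow_right_iff (by norm_num)).1 hcop
  · conv_lhs => rw [← Rat.num_div_den x, hx]
    push_cast; rfl
  · conv_lhs => rw [← Rat.num_div_den y, hy]
    push_cast; rfl

theorem Rat.sq_ne_cube_sub_sixteen (x y : ℚ) : y ^ 2 ≠ x ^ 3 - 16 := by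
  intro h
  obtain ⟨a, b, c, hc, hbc, rfl, rfl⟩ :=
    Rat.exists_eq_div_of_sq_eq_cube_add (k := -16) (h.trans (by push_cast; ring))
  refine sq_add_sixteen_mul_pow_six_ne_cube _ rfl hc hbc (a := a) ?_
  have hc' : (c : ℚ) ≠ 0 := mod_cast hc
  field_simp at h
  have : (b : ℚ) ^ 2 + 16 * c ^ 6 = a ^ 3 := by linarith
  exact mod_cast this

theorem Rat.eq_zero_of_sq_eq_cube_add_sixteen {x y : ℚ} (h : y ^ 2 = x ^ 3 + 16) : x = 0 := by
  obtain ⟨a, b, c, hc, hbc, rfl, rfl⟩ :=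
    Rat.exists_eq_div_of_sq_eq_cube_add (k := 16) (h.trans (by push_cast; ring))
  have hc' : (c : ℚ) ≠ 0 := mod_cast hc
  field_simp at h
  have h' : (b : ℚ) ^ 2 = a ^ 3 + 16 * c ^ 6 := by linarith
  have ha : a = 0 := eq_zero_of_sq_eq_cube_add_sixteen_mul_pow_six (mod_cast h') hc hbc
  simp [ha]

theorem eq_zero_of_add_mul_I_eq_zero {F : Type*} [Field F] [Algebra ℚ F] {i : F}
    (hi : i ^ 2 = -1) {a b : ℚ} (h : algebraMap ℚ F a + algebraMap ℚ F b * i = 0) :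
    a = 0 ∧ b = 0 := by
  have h1 : algebraMap ℚ F (a ^ 2 + b ^ 2) = algebraMap ℚ F 0 := by
    simp only [map_add, map_pow, map_zero]
    linear_combination (algebraMap ℚ F a - algebraMap ℚ F b * i) * h + algebraMap ℚ F b ^ 2 * hi
  have h2 := (algebraMap ℚ F).injective h1
  constructor <;> nlinarith [sq_nonneg a, sq_nonneg b]

theorem exists_eq_add_mul_I {F : Type*} [Field F] [Algebra ℚ F] {i : F} (hi : i ^ 2 = -1)
    (hgen : Algebra.adjoin ℚ {i} = ⊤) (z : F) :
    ∃ a b : ℚ, z = algebraMap ℚ F a + algebraMap ℚ F b * i := by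
  have hz : z ∈ Algebra.adjoin ℚ {i} := hgen ▸ Algebra.mem_top
  induction hz using Algebra.adjoin_induction with
  | mem x hx => exact ⟨0, 1, by simpa using hx⟩
  | algebraMap r => exact ⟨r, 0, by simp⟩
  | add x y _ _ hx hy =>
    obtain ⟨a, b, rfl⟩ := hx
    obtain ⟨c, d, rfl⟩ := hy
    exact ⟨a + c, b + d, by simp only [map_add]; ring⟩
  | mul x y _ _ hx hy =>
    obtain ⟨a, b, rfl⟩ := hx
    obtain ⟨c, d, rfl⟩ := hy
    refine ⟨a * c - b * d, a * d + b * c, ?_⟩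
    simp only [map_add, map_sub, map_mul]
    linear_combination algebraMap ℚ F b * algebraMap ℚ F d * hi

/-- Let `F = ℚ(i)` where `i² = −1`.  The solutions in `F` of `y² = x³ − 16` are exactly
`(0, 4i)` and `(0, −4i)`. -/
theorem points_of_y_sq_eq_x_cubed_sub_sixteen_over_Q_i
    (F : Type*) [Field F] [Algebra ℚ F] (i : F) (hi : i ^ 2 = -1)
    (hgen : Algebra.adjoin ℚ {i} = ⊤) :
    ∀ x y : F, y ^ 2 = x ^ 3 - 16 ↔ (x = 0 ∧ (y = 4 * i ∨ y = -(4 * i))) := by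
  refine fun x y ↦ ⟨fun h ↦ ?_, ?_⟩
  · have hx : x = 0 := by
      obtain ⟨a, b, rfl⟩ := exists_eq_add_mul_I hi hgen x
      obtain ⟨c, d, rfl⟩ := exists_eq_add_mul_I hi hgen y
      obtain ⟨hre, him⟩ := eq_zero_of_add_mul_I_eq_zero hi
        (a := c ^ 2 - d ^ 2 - (a ^ 3 - 3 * a * b ^ 2 - 16))
        (b := 2 * c * d - (3 * a ^ 2 * b - b ^ 3)) <| by
          simp only [map_sub, map_mul, map_pow, map_ofNat]
          generalize algebraMap ℚ F a = a at *
          generalize algebraMap ℚ F b = b at *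
          generalize algebraMap ℚ F c = c at *
          generalize algebraMap ℚ F d = d at *
          linear_combination h + (b ^ 3 * i + 3 * a * b ^ 2 - d ^ 2) * hi
      rcases eq_or_ne b 0 with rfl | hb
      · rcases mul_eq_zero.1 (show c * d = 0 by linarith) with rfl | rfl
        · have := Rat.eq_zero_of_sq_eq_cube_add_sixteen (x := -a) (y := d) (by linarith)
          simp [neg_eq_zero.1 this]
        · exact absurd (by linarith) (Rat.sq_ne_cube_sub_sixteen a c)
      · obtain ⟨l, rfl⟩ : ∃ l, d = l * b := ⟨d / b, by field_simp⟩
        have him' : 2 * c * l - (3 * a ^ 2 - b ^ 2) = 0 :=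
          (mul_eq_zero.1 (show b * (2 * c * l - (3 * a ^ 2 - b ^ 2)) = 0 by linarith)).resolve_left
            hb
        refine absurd ?_ (Rat.sq_ne_cube_sub_sixteen (l ^ 2 - 2 * a) (l * (l ^ 2 - 3 * a) + c))
        linear_combination hre + (l ^ 2 - 3 * a) * him'
    refine ⟨hx, sq_eq_sq_iff_eq_or_eq_neg.1 ?_⟩
    rw [h, hx]
    linear_combination -16 * hi
  · rintro ⟨rfl, rfl | rfl⟩ <;> linear_combination 16 * hi
end
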